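/- For every real b₀ > 0 there exist constants C₀, C₁ > 0 (depending only on b₀, and in particular independent of N and ε) such that for every integer m ≥ 4 and every real ε with 0 < ε ≤ h, where N = m+1 and h = 1/N, the Cholesky factor L of the matrix A satisfies C₀ · ε⁸ / h⁷ ≤ |L(m+3, m+1)| ≤ C₁ · ε⁸ / h⁷. (The entry L(m+3, m+1) is the first fill-in entry in the second block row not adjacent to an original nonzero of A; it has 'level 3' magnitude Θ(ε⁸/h⁷).) -/

import Mathlib

/-- The m² × m² symmetrized 5-point finite-difference matrix for
−ε²Δu + b₀u on a uniform mesh of width h = 1/(m+1) on the unit square.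
Rows/columns r,c : Fin (m^2) encode the 1-based indices r+1, c+1;
the condition ⌈(r+1)/m⌉ = ⌈(c+1)/m⌉ is equivalent to r/m = c/m (Nat division). -/
noncomputable def fdMatrix (m : ℕ) (ε b₀ : ℝ) :
    Matrix (Fin (m ^ 2)) (Fin (m ^ 2)) ℝ := fun r c =>
  if r = c then 4 * ε ^ 2 + (1 / (m + 1) : ℝ) ^ 2 * b₀
  else if (r : ℕ) + m = (c : ℕ) ∨ (c : ℕ) + m = (r : ℕ) then -ε ^ 2
  else if ((r : ℕ) + 1 = (c : ℕ) ∨ (c : ℕ) + 1 = (r : ℕ))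
      ∧ (r : ℕ) / m = (c : ℕ) / m then -ε ^ 2
  else 0

/-- Entries of the matrix as a function of natural numbers. -/
noncomputable def natA (m : ℕ) (a e : ℝ) (r c : ℕ) : ℝ :=
  if r = c then a
  else if r + m = c ∨ c + m = r then -e
  else if (r + 1 = c ∨ c + 1 = r) ∧ r / m = c / m then -e
  else 0

lemma sqle_aux {a b : ℝ} (h : a ^ 2 ≤ b ^ 2) (hb : 0 ≤ b) : a ≤ b := by
  by_contra hc
  push Not at hc
  nlinarith

lemma prod_aux {a b c x y z : ℝ} (ha : 0 ≤ a) (hb : 0 ≤ b) (hc : 0 ≤ c) (h1 : a ≤ x)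
    (h2 : b ≤ y) (h3 : c ≤ z) : a * b * c ≤ x * y * z := by
  have hx := ha.trans h1
  have hy := hb.trans h2
  gcongr

lemma geom_aux (q : ℕ → ℝ) (n : ℕ) (h : ∀ i < n, q (i + 1) ≤ q i / 2) :
    ∑ i ∈ Finset.range (n + 1), q i ≤ 2 * q 0 - q n := by
  induction n with
  | zero => simp; linarith
  | succ n ih =>
    rw [Finset.sum_range_succ]
    have h1 := ih (fun i hi => h i (by omega))
    have h2 := h n (by omega)
    linarith

lemma core (m : ℕ) (hm : 4 ≤ m) (b h e : ℝ) (hb : 0 < b) (hh : 0 < h) (he : 0 < e)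
    (heh : e ≤ h ^ 2) (l : ℕ → ℕ → ℝ) (hpos : ∀ i ≤ m + 2, 0 < l i i)
    (E : ∀ i ≤ m + 2, ∀ j ≤ i, ∑ t ∈ Finset.range j, l i t * l j t + l i j * l j j
      = natA m (4 * e + h ^ 2 * b) e i j) :
    1 / ((4 + b) ^ 3 * √(4 + b)) * (e ^ 4 / h ^ 7) ≤ |l (m + 2) m| ∧
      |l (m + 2) m| ≤ 2 / (b ^ 3 * √b) * (e ^ 4 / h ^ 7) := by
  -- first block is bidiagonal
  have B0 : ∀ k j, k + 1 < j → j < m → l j k = 0 := by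
    intro k
    induction k using Nat.strong_induction_on with
    | _ k ih =>
      intro j hkj hj
      have h1 := E j (by omega) k (by omega)
      rw [Finset.sum_eq_zero (fun t ht => by
        rw [ih t (Finset.mem_range.1 ht) j (by have := Finset.mem_range.1 ht; omega) hj, zero_mul])] at h1
      have h2 : natA m (4 * e + h ^ 2 * b) e j k = 0 := by
        unfold natA
        rw [if_neg (by omega), if_neg (by omega), if_neg (by omega)]
      rw [h2, zero_add] at h1
      exact (mul_eq_zero.1 h1).resolve_right (hpos k (by omega)).ne'
  have B1 : ∀ j, j + 1 < m → l (j + 1) j * l j j = -e := by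
    intro j hj
    have h1 := E (j + 1) (by omega) j (by omega)
    rw [Finset.sum_eq_zero (fun t ht => by
        rw [B0 t (j + 1) (by have := Finset.mem_range.1 ht; omega) hj, zero_mul])] at h1
    have h2 : natA m (4 * e + h ^ 2 * b) e (j + 1) j = -e := by
      unfold natA
      rw [if_neg (by omega), if_neg (by omega), if_pos]
      rw [Nat.div_eq_of_lt hj, Nat.div_eq_of_lt (by omega : j < m)]
      simp
    rw [h2, zero_add] at h1
    exact h1
  have Add : ∀ i, natA m (4 * e + h ^ 2 * b) e i i = 4 * e + h ^ 2 * b := by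
    intro i; simp [natA]
  have D0 : l 0 0 * l 0 0 = 4 * e + h ^ 2 * b := by
    have := E 0 (by omega) 0 le_rfl
    rw [Add] at this
    simpa using this
  have D1 : ∀ j, j + 1 < m →
      l (j + 1) j * l (j + 1) j + l (j + 1) (j + 1) * l (j + 1) (j + 1) = 4 * e + h ^ 2 * b := by
    intro j hj
    have h1 := E (j + 1) (by omega) (j + 1) le_rfl
    rw [Add, Finset.sum_range_succ, Finset.sum_eq_zero (fun t ht => by
        rw [B0 t (j + 1) (by have := Finset.mem_range.1 ht; omega) hj, zero_mul]), zero_add] at h1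
    exact h1
  have hhb : 0 < h ^ 2 * b := by positivity
  have Dlow : ∀ j < m, 3 * e + h ^ 2 * b ≤ l j j * l j j := by
    intro j
    induction j with
    | zero => intro _; rw [D0]; linarith
    | succ j ih =>
      intro hj
      have h1 := ih (by omega)
      have h2 := B1 j hj
      have h3 := D1 j hj
      have h4 : (l (j + 1) j * l (j + 1) j) * (l j j * l j j) = e ^ 2 := by
        calc _ = (l (j + 1) j * l j j) ^ 2 := by ring
          _ = _ := by rw [h2]; ring
      have h5 : l (j + 1) j * l (j + 1) j ≤ e := by
        by_contra hc
        push Not at hc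
        nlinarith
      linarith
  have Dup : ∀ j < m, l j j * l j j ≤ 4 * e + h ^ 2 * b := by
    intro j hj
    cases j with
    | zero => exact D0.le
    | succ j => nlinarith [D1 j hj, mul_self_nonneg (l (j + 1) j)]
  -- second block rows
  have R0 : ∀ k ≤ 2, ∀ j < k, l (m + k) j = 0 := by
    intro k hk j
    induction j using Nat.strong_induction_on with
    | _ j ih =>
      intro hj
      have h1 := E (m + k) (by omega) j (by omega)
      rw [Finset.sum_eq_zero (fun t ht => by
        rw [ih t (Finset.mem_range.1 ht) (by have := Finset.mem_range.1 ht; omega), zero_mul])] at h1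
      have h2 : natA m (4 * e + h ^ 2 * b) e (m + k) j = 0 := by
        unfold natA
        rw [if_neg (by omega), if_neg (by omega), if_neg (by omega)]
      rw [h2, zero_add] at h1
      exact (mul_eq_zero.1 h1).resolve_right (hpos j (by omega)).ne'
  have R1 : ∀ k ≤ 2, l (m + k) k * l k k = -e := by
    intro k hk
    have h1 := E (m + k) (by omega) k (by omega)
    rw [Finset.sum_eq_zero (fun t ht => by
        rw [R0 k hk t (Finset.mem_range.1 ht), zero_mul])] at h1
    have h2 : natA m (4 * e + h ^ 2 * b) e (m + k) k = -e := by
      unfold natA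
      rw [if_neg (by omega), if_pos (by omega)]
    rw [h2, zero_add] at h1
    exact h1
  have R2 : ∀ k ≤ 2, ∀ j, k ≤ j → j + 1 < m →
      l (m + k) (j + 1) * (l (j + 1) (j + 1) * l j j) = l (m + k) j * e := by
    intro k hk j hkj hj
    have h1 := E (m + k) (by omega) (j + 1) (by omega)
    rw [Finset.sum_range_succ, Finset.sum_eq_zero (fun t ht => by
        rw [B0 t (j + 1) (by have := Finset.mem_range.1 ht; omega) hj, mul_zero]), zero_add] at h1
    have h2 : natA m (4 * e + h ^ 2 * b) e (m + k) (j + 1) = 0 := by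
      unfold natA
      rw [if_neg (by omega), if_neg (by omega), if_neg]
      rintro ⟨-, h3⟩
      rw [Nat.div_eq_of_lt hj] at h3
      have : 0 < (m + k) / m := Nat.div_pos (by omega) (by omega)
      omega
    rw [h2] at h1
    have h3 := B1 j hj
    linear_combination (l j j) * h1 - l (m + k) j * h3
  have SS : ∀ j, j + 1 < m → 3 * e ≤ l (j + 1) (j + 1) * l j j := by
    intro j hj
    have h1 := Dlow j (by omega)
    have h2 := Dlow (j + 1) hj
    have p1 := hpos j (by omega)
    have p2 := hpos (j + 1) (by omega)
    refine sqle_aux ?_ (by positivity)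
    calc (3 * e) ^ 2 = (3 * e) * (3 * e) := by ring
      _ ≤ (l (j + 1) (j + 1) * l (j + 1) (j + 1)) * (l j j * l j j) := by
        apply mul_le_mul <;> first | positivity | linarith
      _ = _ := by ring
  -- signs and decay
  have Neg : ∀ k ≤ 2, ∀ i, k + i < m → l (m + k) (k + i) < 0 := by
    intro k hk i
    induction i with
    | zero =>
      intro _
      have h1 := R1 k hk
      have := hpos k (by omega)
      rw [add_zero]
      by_contra hc
      push Not at hc
      nlinarith [mul_nonneg hc this.le]
    | succ i ih =>
      intro hi
      have h1 := R2 k hk (k + i) (by omega) (by omega)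
      have h2 := ih (by omega)
      have h3 := SS (k + i) (by omega)
      by_contra hc
      push Not at hc
      have h4 := mul_nonneg hc (by linarith : 0 ≤ l (k + i + 1) (k + i + 1) * l (k + i) (k + i))
      have h5 := mul_neg_of_neg_of_pos h2 he
      rw [← add_assoc] at h4
      linarith
  have Dec : ∀ k ≤ 2, ∀ j, k ≤ j → j + 1 < m →
      -l (m + k) (j + 1) * 3 ≤ -l (m + k) j := by
    intro k hk j hkj hj
    have h1 := R2 k hk j hkj hj
    have h3 := SS j hj
    have h4 := Neg k hk (j + 1 - k) (by omega)
    rw [show k + (j + 1 - k) = j + 1 by omega] at h4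
    have h5 : (-l (m + k) (j + 1)) * (3 * e) ≤
      (-l (m + k) (j + 1)) * (l (j + 1) (j + 1) * l j j) :=
      mul_le_mul_of_nonneg_left h3 (by linarith)
    have : (-l (m + k) (j + 1) * 3) * e ≤ (-l (m + k) j) * e := by linarith
    exact le_of_mul_le_mul_right this he
  obtain ⟨n, rfl⟩ : ∃ n, m = n + 3 := ⟨m - 3, by omega⟩
  set m := n + 3 with hmdef
  have N0 : ∀ j < m, l m j < 0 := by
    intro j hj
    have := Neg 0 (by omega) j (by omega)
    simpa using this
  have N2 : ∀ i < n + 1, l (m + 2) (i + 2) < 0 := by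
    intro j hj
    have := Neg 2 (by omega) j (by omega)
    rwa [add_comm 2 j] at this
  have Dc0 : ∀ j, j + 1 < m → -l m (j + 1) * 3 ≤ -l m j := by
    intro j hj
    simpa using Dec 0 (by omega) j (by omega) hj
  have Dc2 : ∀ i, i < n → -l (m + 2) (i + 1 + 2) * 3 ≤ -l (m + 2) (i + 2) := by
    intro i hi
    simpa using Dec 2 (by omega) (i + 2) (by omega) (by omega)
  -- the diagonal entry
  have M : (∑ t ∈ Finset.range m, l m t * l m t) + l m m * l m m = 4 * e + h ^ 2 * b := by
    rw [E m (by omega) m le_rfl, Add]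
  have S1 : ∑ t ∈ Finset.range m, l m t * l m t ≤ e := by
    have g := geom_aux (fun t => l m t * l m t) (n + 2) (by
      intro i hi
      have h1 := Dc0 i (by omega)
      have h2 := N0 (i + 1) (by omega)
      show l m (i + 1) * l m (i + 1) ≤ l m i * l m i / 2
      nlinarith)
    have h0 : (l m 0 * l m 0) * (l 0 0 * l 0 0) = e ^ 2 := by
      have := R1 0 (by omega)
      rw [add_zero] at this
      calc _ = (l m 0 * l 0 0) ^ 2 := by ring
        _ = _ := by rw [this]; ring
    have h1 : l m 0 * l m 0 ≤ e / 2 := by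
      rw [D0] at h0
      by_contra hc
      push Not at hc
      nlinarith
    have h2 := mul_self_nonneg (l m (n + 2))
    calc _ ≤ _ := g
      _ ≤ e := by linarith
  have S0 : 0 ≤ ∑ t ∈ Finset.range m, l m t * l m t :=
    Finset.sum_nonneg fun t _ => mul_self_nonneg _
  -- the target
  have T : (∑ t ∈ Finset.range m, l (m + 2) t * l m t) + l (m + 2) m * l m m = 0 := by
    rw [E (m + 2) le_rfl m (by omega)]
    unfold natA
    rw [if_neg (by omega), if_neg (by omega), if_neg (by omega)]
  have TS : ∑ t ∈ Finset.range m, l (m + 2) t * l m t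
      = ∑ i ∈ Finset.range (n + 1), l (m + 2) (i + 2) * l m (i + 2) := by
    rw [hmdef, Finset.sum_range_succ', Finset.sum_range_succ', ← hmdef,
      R0 2 le_rfl 0 (by omega), R0 2 le_rfl (0 + 1) (by omega)]
    simp
  set P := l (m + 2) 2 * l m 2 with hP
  have Tup : ∑ i ∈ Finset.range (n + 1), l (m + 2) (i + 2) * l m (i + 2) ≤ 2 * P := by
    have g := geom_aux (fun i => l (m + 2) (i + 2) * l m (i + 2)) n (by
      intro i hi
      have h1 := Dc0 (i + 2) (by omega)
      have h2 := N0 (i + 1 + 2) (by omega)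
      have h3 := Dc2 i hi
      have h4 := N2 (i + 1) (by omega)
      show l (m + 2) (i + 1 + 2) * l m (i + 1 + 2) ≤ l (m + 2) (i + 2) * l m (i + 2) / 2
      have h5 : -l m (i + 1 + 2) * 3 ≤ -l m (i + 2) := by
        rw [show i + 1 + 2 = i + 2 + 1 by ring]; exact h1
      nlinarith [mul_pos_of_neg_of_neg h2 h4, mul_le_mul h3 h5 (by linarith) (by linarith)])
    have h2 := mul_pos_of_neg_of_neg (N2 n (by omega)) (N0 (n + 2) (by omega))
    calc _ ≤ _ := g
      _ ≤ 2 * P := by simp only [zero_add]; linarith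
  have Tlow : P ≤ ∑ i ∈ Finset.range (n + 1), l (m + 2) (i + 2) * l m (i + 2) := by
    refine Finset.single_le_sum (f := fun i => l (m + 2) (i + 2) * l m (i + 2)) (fun i hi => ?_)
      (Finset.mem_range.2 (Nat.succ_pos n))
    have := Finset.mem_range.1 hi
    exact (mul_pos_of_neg_of_neg (N2 i this) (N0 (i + 2) (by omega))).le
  have PP : P * ((l 2 2 * l 2 2) * (l 1 1 * l 1 1) * (l 0 0 * l 0 0)) = e ^ 4 := by
    have a1 := R1 2 le_rfl
    have a2 := R2 0 (by omega) 1 (by omega) (by omega)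
    have a3 := R2 0 (by omega) 0 (by omega) (by omega)
    have a4 := R1 0 (by omega)
    simp only [add_zero, zero_add] at a2 a3 a4
    norm_num at a2
    calc _ = (l (m + 2) 2 * l 2 2) * ((l m 2 * (l 2 2 * l 1 1)) * l 1 1 * l 0 0 * l 0 0) := by
          rw [hP]; ring
      _ = (-e) * ((l m 1 * (l 1 1 * l 0 0)) * l 0 0 * e) := by rw [a1, a2]; ring
      _ = (-e) * ((l m 0 * l 0 0) * e * e) := by rw [a3]; ring
      _ = e ^ 4 := by rw [a4]; ring
  have Ppos : 0 < P := mul_pos_of_neg_of_neg (N2 0 (by omega)) (N0 2 (by omega))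
  have lo : ∀ j < m, h ^ 2 * b ≤ l j j * l j j := fun j hj => by linarith [Dlow j hj]
  have up : ∀ j < m, l j j * l j j ≤ h ^ 2 * (4 + b) := fun j hj => by linarith [Dup j hj]
  have Plow : e ^ 4 ≤ P * (h ^ 2 * (4 + b)) ^ 3 := by
    rw [← PP]
    apply mul_le_mul_of_nonneg_left _ Ppos.le
    calc _ ≤ (h ^ 2 * (4 + b)) * (h ^ 2 * (4 + b)) * (h ^ 2 * (4 + b)) := by
          exact prod_aux (mul_self_nonneg _) (mul_self_nonneg _) (mul_self_nonneg _)
            (up 2 (by omega)) (up 1 (by omega)) (up 0 (by omega))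
      _ = _ := by ring
  have Pup : P * (h ^ 2 * b) ^ 3 ≤ e ^ 4 := by
    rw [← PP]
    apply mul_le_mul_of_nonneg_left _ Ppos.le
    calc _ = (h ^ 2 * b) * (h ^ 2 * b) * (h ^ 2 * b) := by ring
      _ ≤ _ := by
          exact prod_aux hhb.le hhb.le hhb.le
            (lo 2 (by omega)) (lo 1 (by omega)) (lo 0 (by omega))
  have mpos := hpos m (by omega)
  have Mlow : h * √b ≤ l m m := by
    refine sqle_aux ?_ mpos.le
    rw [mul_pow, Real.sq_sqrt hb.le]
    nlinarith
  have Mup : l m m ≤ h * √(4 + b) := by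
    refine sqle_aux ?_ (by positivity)
    rw [mul_pow, Real.sq_sqrt (by linarith)]
    nlinarith
  rw [TS] at T
  have Tabs : |l (m + 2) m| * l m m = ∑ i ∈ Finset.range (n + 1), l (m + 2) (i + 2) * l m (i + 2) := by
    have : l (m + 2) m ≤ 0 := by
      by_contra hc
      push Not at hc
      have := mul_pos hc mpos
      linarith
    rw [abs_of_nonpos this]
    linarith
  have sb : 0 < √b := Real.sqrt_pos.2 hb
  have s4 : 0 < √(4 + b) := Real.sqrt_pos.2 (by linarith)
  constructor
  · rw [div_mul_div_comm, one_mul, div_le_iff₀ (by positivity)]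
    calc e ^ 4 ≤ P * (h ^ 2 * (4 + b)) ^ 3 := Plow
      _ ≤ (|l (m + 2) m| * l m m) * (h ^ 2 * (4 + b)) ^ 3 := by
        gcongr; rw [Tabs]; exact Tlow
      _ ≤ (|l (m + 2) m| * (h * √(4 + b))) * (h ^ 2 * (4 + b)) ^ 3 := by gcongr
      _ = _ := by ring
  · rw [div_mul_div_comm, le_div_iff₀ (by positivity)]
    calc _ = (|l (m + 2) m| * (h * √b)) * (h ^ 2 * b) ^ 3 := by ring
      _ ≤ (|l (m + 2) m| * l m m) * (h ^ 2 * b) ^ 3 := by gcongr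
      _ ≤ (2 * P) * (h ^ 2 * b) ^ 3 := by
        exact mul_le_mul_of_nonneg_right (Tabs.le.trans Tup) (by positivity)
      _ ≤ 2 * e ^ 4 := by linarith

theorem stmt_5 (b₀ : ℝ) (hb₀ : 0 < b₀) :
    ∃ C₀ C₁ : ℝ, 0 < C₀ ∧ 0 < C₁ ∧
      ∀ m : ℕ, ∀ hm : 4 ≤ m,
      ∀ ε : ℝ, 0 < ε → ε ≤ 1 / (m + 1 : ℝ) →
      ∀ L : Matrix (Fin (m ^ 2)) (Fin (m ^ 2)) ℝ,
        (∀ i j : Fin (m ^ 2), i < j → L i j = 0) →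
        (∀ i : Fin (m ^ 2), 0 < L i i) →
        fdMatrix m ε b₀ = L * L.transpose →
        C₀ * (ε ^ 8 / (1 / (m + 1 : ℝ)) ^ 7) ≤
            |L ⟨m + 2, by nlinarith⟩ ⟨m, by nlinarith⟩| ∧
          |L ⟨m + 2, by nlinarith⟩ ⟨m, by nlinarith⟩| ≤
            C₁ * (ε ^ 8 / (1 / (m + 1 : ℝ)) ^ 7) := by
  have sb : 0 < √b₀ := Real.sqrt_pos.2 hb₀
  have s4 : 0 < √(4 + b₀) := Real.sqrt_pos.2 (by linarith)
  refine ⟨1 / ((4 + b₀) ^ 3 * √(4 + b₀)), 2 / (b₀ ^ 3 * √b₀), by positivity, by positivity, ?_⟩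
  intro m hm ε hε hεh L hL hpos hA
  have hlt : ∀ i, i ≤ m + 2 → i < m ^ 2 := fun i hi => by nlinarith
  have key := core m hm b₀ (1 / (m + 1 : ℝ)) (ε ^ 2) hb₀ (by positivity) (by positivity)
    (by gcongr) (fun i j => if h : i < m ^ 2 ∧ j < m ^ 2 then L ⟨i, h.1⟩ ⟨j, h.2⟩ else 0)
    (fun i hi => by
      simp only [hlt i hi, and_self, dif_pos]
      exact hpos _)
    (fun i hi j hj => by
      have hi' := hlt i hi
      have hj' := hlt j (by omega)
      have h1 : natA m (4 * ε ^ 2 + (1 / (m + 1 : ℝ)) ^ 2 * b₀) (ε ^ 2) i j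
          = fdMatrix m ε b₀ ⟨i, hi'⟩ ⟨j, hj'⟩ := by
        simp [natA, fdMatrix]
      rw [h1, hA, Matrix.mul_apply, ← Finset.sum_range_succ
        (fun t => (if h : i < m ^ 2 ∧ t < m ^ 2 then L ⟨i, h.1⟩ ⟨t, h.2⟩ else 0) *
          (if h : j < m ^ 2 ∧ t < m ^ 2 then L ⟨j, h.1⟩ ⟨t, h.2⟩ else 0))]
      rw [Finset.sum_subset (Finset.range_subset_range.2 (by omega : j + 1 ≤ m ^ 2))]
      · rw [← Fin.sum_univ_eq_sum_range]
        refine Finset.sum_congr rfl fun t _ => ?_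
        simp [hi', hj', t.2]
      · intro t ht ht'
        have h2 := Finset.mem_range.1 ht
        have h3 : j < t := by
          by_contra hc
          exact ht' (Finset.mem_range.2 (by omega))
        simp only [hj', h2, and_self, dif_pos]
        rw [hL ⟨j, hj'⟩ ⟨t, h2⟩ h3, mul_zero])
  simp only [hlt (m + 2) le_rfl, hlt m (by omega), and_self, dif_pos] at key
  rw [show (ε ^ 2) ^ 4 = ε ^ 8 by ring] at key
  exact key
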